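/- arXiv:2409.19195 — 3 statements merged into one kernel-verified Lean document; each statement's English description precedes it below -/
import Mathlib

section
/- Let v and w be binary words such that neither is a subword of the other (in particular v ≠ w). Then for every p ∈ (0,1), the quantity ww_p + vv_p − wv_p − vw_p is nonzero and Win(v,w;p) = (ww_p − wv_p)/(ww_p + vv_p − wv_p − vw_p). -/
open scoped BigOperators

/-- Bernoulli(p) weight of a binary word `u`: `ℙ_p(u) = p^{‖u‖₁} (1-p)^{‖u‖₀}`. -/
noncomputable def wProb (p : ℝ) (u : List Bool) : ℝ :=
  p ^ (u.count true) * (1 - p) ^ (u.count false)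

/-- Number of occurrences of `v` as a contiguous subword of `u`. -/
def occCount (v u : List Bool) : ℕ :=
  (List.range (u.length + 1)).countP (fun i => decide (v <+: u.drop i))

/-- `Ω_{v,w}(v)`: binary words having `v` as a suffix, containing `v` exactly once
as a subword, and not containing `w` as a subword.  (`Ω_{v,w}(w) = OmegaWin w v`.) -/
def OmegaWin (v w : List Bool) : Set (List Bool) :=
  {u | v <:+ u ∧ occCount v u = 1 ∧ ¬ (w <:+: u)}

/-- The win probability `Win(v,w;p) = ∑_{u ∈ Ω_{v,w}(v)} ℙ_p(u)`. -/
noncomputable def Win (v w : List Bool) (p : ℝ) : ℝ :=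
  ∑' u : OmegaWin v w, wProb p u

/-- The correlation polynomial `vw_p = ∑_{u ∈ O(v,w)} ℙ_p(u)⁻¹`, where `O(v,w)` is
the set of nonempty words that are simultaneously a suffix of `v` and a prefix of `w`. -/
noncomputable def corr (v w : List Bool) (p : ℝ) : ℝ :=
  ∑ i ∈ Finset.Icc 1 w.length,
    if w.take i <:+ v then (wProb p (w.take i))⁻¹ else 0

/-- `Ω*_{v,w}(v) = {x : x ++ v ∈ Ω_{v,w}(v)}` (with `x` possibly empty). -/
def OmegaStarV (v w : List Bool) : Set (List Bool) :=
  {x | x ++ v ∈ OmegaWin v w}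

/-- Property `R`: `Ω*_{v,w}(v) = Ω*_{v,w}(w)`. -/
def PropR (v w : List Bool) : Prop :=
  OmegaStarV v w = {x | x ++ w ∈ OmegaWin w v}

/-- `D(v,w)`: nonempty proper prefixes `v₁⋯v_{n-k}` of `v` (`1 ≤ k ≤ n-1`) such that
`w₁⋯w_k = v_{n-k+1}⋯v_n`. -/
def Dset (v w : List Bool) : Set (List Bool) :=
  {x | ∃ k, 1 ≤ k ∧ k ≤ v.length - 1 ∧ k ≤ w.length ∧
    x = v.take (v.length - k) ∧ w.take k = v.drop (v.length - k)}

/-- `F(v,w) = D(v,v) ∪ D(w,w) ∪ D(w,v) ∪ D(v,w)`. -/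
def Fset (v w : List Bool) : Set (List Bool) :=
  Dset v v ∪ Dset w w ∪ Dset w v ∪ Dset v w

/-- `a^m`: concatenation of `m` copies of the word `a`. -/
def wpow (a : List Bool) (m : ℕ) : List Bool :=
  (List.replicate m a).flatten

open scoped ENNReal

/-- The Bernoulli weight of a word as an extended nonnegative real. -/
noncomputable def wt (p : ℝ) (u : List Bool) : ℝ≥0∞ := ENNReal.ofReal (wProb p u)

/-- The total weight of a set of words. -/
noncomputable def mass (p : ℝ) (T : Set (List Bool)) : ℝ≥0∞ := ∑' u, T.indicator (wt p) u

/-- The words having no element of `X` as a subword. -/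
def avoiders (X : Finset (List Bool)) : Set (List Bool) := {u | ∀ y ∈ X, ¬ y <:+: u}

/-- The words ending in `y` none of whose proper prefixes contains an element of `X`. -/
def firstHits (X : Finset (List Bool)) (y : List Bool) : Set (List Bool) :=
  {u | y <:+ u ∧ u.dropLast ∈ avoiders X}

/-- The correlation polynomial as an extended nonnegative real. -/
noncomputable def ecorr (p : ℝ) (y x : List Bool) : ℝ≥0∞ :=
  ∑ i ∈ Finset.Icc 1 x.length, if x.take i <:+ y then (wt p (x.take i))⁻¹ else 0

section Weights

variable {p : ℝ} (hp : p ∈ Set.Ioo (0 : ℝ) 1)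
include hp

theorem wProb_pos (u : List Bool) : 0 < wProb p u := by
  have h1 := hp.1
  have h2 : 0 < 1 - p := sub_pos.2 hp.2
  unfold wProb
  positivity

theorem wt_append (u v : List Bool) : wt p (u ++ v) = wt p u * wt p v := by
  unfold wt
  rw [← ENNReal.ofReal_mul (wProb_pos hp u).le]
  congr 1
  simp only [wProb, List.count_append, pow_add]
  ring

theorem wt_ne_zero (u : List Bool) : wt p u ≠ 0 := by
  simpa [wt] using wProb_pos hp u

omit hp in
theorem wt_ne_top (u : List Bool) : wt p u ≠ ∞ := ENNReal.ofReal_ne_top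

theorem wt_singleton_add : wt p [true] + wt p [false] = 1 := by
  unfold wt
  rw [← ENNReal.ofReal_add (wProb_pos hp _).le (wProb_pos hp _).le]
  simp [wProb]

omit hp in
theorem wt_nil : wt p [] = 1 := by simp [wt, wProb]

theorem toReal_ecorr (y x : List Bool) : (ecorr p y x).toReal = corr y x p := by
  unfold ecorr corr
  rw [ENNReal.toReal_sum]
  · refine Finset.sum_congr rfl fun i _ => ?_
    split_ifs
    · rw [ENNReal.toReal_inv, wt, ENNReal.toReal_ofReal (wProb_pos hp _).le]
    · simp
  · intro i _
    split_ifs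
    · exact ENNReal.inv_ne_top.2 (wt_ne_zero hp _)
    · simp

theorem ecorr_ne_top (y x : List Bool) : ecorr p y x ≠ ∞ := by
  unfold ecorr
  refine ENNReal.sum_ne_top.2 fun i _ => ?_
  split_ifs
  · exact ENNReal.inv_ne_top.2 (wt_ne_zero hp _)
  · simp

omit hp in
theorem mass_mono {S T : Set (List Bool)} (h : S ⊆ T) : mass p S ≤ mass p T :=
  ENNReal.tsum_le_tsum fun u => Set.indicator_le_indicator_of_subset h (fun _ => zero_le) u

omit hp in
theorem mass_union {S T : Set (List Bool)} (h : Disjoint S T) :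
    mass p (S ∪ T) = mass p S + mass p T := by
  unfold mass
  rw [Set.indicator_union_of_disjoint h, ← ENNReal.tsum_add]

omit hp in
theorem mass_singleton (u : List Bool) : mass p {u} = wt p u := by
  unfold mass
  rw [tsum_eq_single u]
  · simp
  · intro v hv
    simp [hv]

omit hp in
theorem mass_ne_top_of_finite {T : Set (List Bool)} (h : T.Finite) : mass p T ≠ ∞ := by
  unfold mass
  rw [tsum_eq_sum (s := h.toFinset)]
  · refine ENNReal.sum_ne_top.2 fun u hu => ?_
    rw [Set.indicator_of_mem (by simpa using hu)]
    exact wt_ne_top u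
  · intro u hu
    exact Set.indicator_of_notMem (by simpa using hu) _

/-- One-letter extensions of the words of `T` have the same total weight as `T`. -/
theorem mass_extensions (T : Set (List Bool)) :
    mass p {u | u ≠ [] ∧ u.dropLast ∈ T} = mass p T := by
  classical
  unfold mass
  have hinj : Function.Injective fun x : List Bool × Bool => x.1 ++ [x.2] := by
    rintro ⟨s, c⟩ ⟨t, d⟩ h
    simpa using h
  rw [← hinj.tsum_eq]
  · rw [ENNReal.summable.tsum_prod' fun _ => ENNReal.summable]
    refine tsum_congr fun s => ?_
    by_cases hs : s ∈ T
    · simp [Set.indicator, hs, wt_append hp s, ← mul_add, wt_singleton_add hp]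
    · simp [Set.indicator, hs]
  · intro u hu
    have hu' := Set.mem_of_indicator_ne_zero hu
    exact ⟨(u.dropLast, u.getLast hu'.1), List.dropLast_append_getLast hu'.1⟩

/-- The leaves of a prefix-closed set of finite weight have total weight one. -/
theorem mass_leaves {T : Set (List Bool)} (h0 : [] ∈ T) (hT : ∀ u ∈ T, u.dropLast ∈ T)
    (hfin : mass p T ≠ ∞) : mass p {u | u.dropLast ∈ T ∧ u ∉ T} = 1 := by
  have e1 : {u | u ≠ [] ∧ u.dropLast ∈ T} ∪ {[]} = T ∪ {u | u.dropLast ∈ T ∧ u ∉ T} := by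
    ext u
    by_cases hu : u ∈ T
    · by_cases hn : u = [] <;> simp [hu, hn, hT u hu, h0]
    · have hn : u ≠ [] := by rintro rfl; exact hu h0
      simp [hu, hn]
  have d1 : Disjoint {u : List Bool | u ≠ [] ∧ u.dropLast ∈ T} {[]} := by simp
  have d2 : Disjoint T {u | u.dropLast ∈ T ∧ u ∉ T} :=
    Set.disjoint_left.2 fun u hu hu' => hu'.2 hu
  have e2 := congrArg (mass p) e1
  rw [mass_union d1, mass_union d2, mass_extensions hp, mass_singleton, wt_nil] at e2
  exact ((ENNReal.add_right_inj hfin).1 e2).symm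

/-- Kraft's inequality for the leaves of a prefix-closed set. -/
theorem mass_leaves_le_one {T : Set (List Bool)} (h0 : [] ∈ T) (hT : ∀ u ∈ T, u.dropLast ∈ T) :
    mass p {u | u.dropLast ∈ T ∧ u ∉ T} ≤ 1 := by
  classical
  conv_lhs => unfold mass
  rw [ENNReal.tsum_eq_iSup_sum]
  refine iSup_le fun F => ?_
  let n := F.sup List.length
  let T' : Set (List Bool) := {u | u ∈ T ∧ u.length < n + 1}
  have hfin : mass p T' ≠ ∞ :=
    mass_ne_top_of_finite ((List.finite_length_lt Bool (n + 1)).subset fun u hu => hu.2)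
  have h1 : mass p {u | u.dropLast ∈ T' ∧ u ∉ T'} = 1 := by
    refine mass_leaves hp ⟨h0, by simp⟩ (fun u hu => ⟨hT u hu.1, ?_⟩) hfin
    have := hu.2
    rw [List.length_dropLast]
    omega
  rw [← h1]
  unfold mass
  refine le_trans (Finset.sum_le_sum fun u hu => ?_) (ENNReal.sum_le_tsum F)
  by_cases h : u ∈ {u | u.dropLast ∈ T ∧ u ∉ T}
  · have hlen : u.length ≤ n := Finset.le_sup (f := List.length) hu
    have h' : u ∈ {u | u.dropLast ∈ T' ∧ u ∉ T'} := by
      refine ⟨⟨h.1, ?_⟩, fun h'' => h.2 h''.1⟩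
      rw [List.length_dropLast]
      omega
    rw [Set.indicator_of_mem h, Set.indicator_of_mem h']
  · rw [Set.indicator_of_notMem h]
    exact zero_le

/-- Stripping a fixed suffix `t` divides the weight by the weight of `t`. -/
theorem mass_strip_suffix (T : Set (List Bool)) (t : List Bool) :
    mass p {s | s ++ t ∈ T} = mass p {u | u ∈ T ∧ t <:+ u} * (wt p t)⁻¹ := by
  classical
  unfold mass
  have hinj : Function.Injective fun s : List Bool => s ++ t := fun s s' h => by simpa using h
  rw [← hinj.tsum_eq (f := Set.indicator {u | u ∈ T ∧ t <:+ u} (wt p)), ← ENNReal.tsum_mul_right]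
  · refine tsum_congr fun s => ?_
    by_cases hs : s ++ t ∈ T
    · simp [Set.indicator, hs, wt_append hp s, mul_assoc,
        ENNReal.mul_inv_cancel (wt_ne_zero hp t) (wt_ne_top t)]
    · simp [Set.indicator, hs]
  · intro u hu
    exact (Set.mem_of_indicator_ne_zero hu).2

end Weights

section Combinatorics

variable {X : Finset (List Bool)}

theorem avoiders_antitone {u u' : List Bool} (h : u <:+: u') (hu : u' ∈ avoiders X) :
    u ∈ avoiders X := fun y hy hyu => hu y hy (hyu.trans h)

theorem firstHits_notMem_avoiders {y u : List Bool} (hy : y ∈ X) (hu : u ∈ firstHits X y) :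
    u ∉ avoiders X := fun h => h y hy hu.1.isInfix

theorem mem_firstHits_unique (hX : ∀ x ∈ X, ∀ y ∈ X, x <:+: y → x = y) {y z u : List Bool}
    (hy : y ∈ X) (hz : z ∈ X) (huy : u ∈ firstHits X y) (huz : u ∈ firstHits X z) : y = z := by
  rcases List.suffix_or_suffix_of_suffix huy.1 huz.1 with h | h
  · exact hX y hy z hz h.isInfix
  · exact (hX z hz y hy h.isInfix).symm

theorem exists_mem_firstHits_iff (hne : ∀ x ∈ X, x ≠ []) (u : List Bool) :
    (∃ y ∈ X, u ∈ firstHits X y) ↔ u.dropLast ∈ avoiders X ∧ u ∉ avoiders X := by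
  constructor
  · rintro ⟨y, hy, hu⟩
    exact ⟨hu.2, firstHits_notMem_avoiders hy hu⟩
  · rintro ⟨h1, h2⟩
    simp only [avoiders, Set.mem_ofPred_eq, not_forall, not_not] at h2
    obtain ⟨y, hy, hyu⟩ := h2
    refine ⟨y, hy, ?_, h1⟩
    have hu : u ≠ [] := by
      rintro rfl
      exact hne y hy (List.infix_nil.1 hyu)
    rw [← List.dropLast_append_getLast hu, List.infix_concat_iff] at hyu
    rcases hyu with h | h
    · rwa [List.dropLast_append_getLast hu] at h
    · exact absurd h (h1 y hy)

theorem nil_mem_avoiders (hne : ∀ x ∈ X, x ≠ []) : [] ∈ avoiders X := fun y hy h =>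
  hne y hy (List.infix_nil.1 h)

theorem prefix_dropLast_append_take {x s : List Bool} {i j : ℕ} (hij : i < j)
    (hj : j ≤ x.length) : s ++ x.take i <+: (s ++ x.take j).dropLast := by
  refine List.prefix_of_prefix_length_le
    ((List.prefix_append_right_inj s).2 (List.take_prefix_take_left hij.le))
    (List.dropLast_prefix _) ?_
  simp only [List.length_append, List.length_take, List.length_dropLast]
  omega

/-- An avoiding word `s` followed by `x ∈ X` has exactly one prefix that is a first hit, and it is
longer than `s`. -/
theorem sum_firstHits_indicator (hX : ∀ x ∈ X, ∀ y ∈ X, x <:+: y → x = y)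
    (hne : ∀ x ∈ X, x ≠ []) {x : List Bool} (hx : x ∈ X) (f : List Bool → ℝ≥0∞)
    (s : List Bool) :
    (avoiders X).indicator f s = ∑ y ∈ X, ∑ i ∈ Finset.Icc 1 x.length,
      {s | s ++ x.take i ∈ firstHits X y}.indicator f s := by
  classical
  by_cases hs : s ∈ avoiders X
  · have hex : ∃ i, s ++ x.take i ∉ avoiders X :=
      ⟨x.length, fun h => h x hx (by simpa using (List.suffix_append s x).isInfix)⟩
    set i := Nat.find hex with hi
    have hi1 : s ++ x.take i ∉ avoiders X := Nat.find_spec hex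
    have hi0 : 1 ≤ i := by
      by_contra h
      have h0 : i = 0 := by omega
      rw [h0] at hi1
      exact hi1 (by simpa using hs)
    have hil : i ≤ x.length := Nat.find_min' hex
      fun h => h x hx (by simpa using (List.suffix_append s x).isInfix)
    have hlt : s ++ x.take (i - 1) ∈ avoiders X :=
      not_not.1 (Nat.find_min hex (show i - 1 < Nat.find hex by omega))
    have hdrop : (s ++ x.take i).dropLast = s ++ x.take (i - 1) := by
      refine ((prefix_dropLast_append_take (by omega) hil).eq_of_length ?_).symm
      simp only [List.length_append, List.length_take, List.length_dropLast]
      omega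
    obtain ⟨y, hy, hyu⟩ := (exists_mem_firstHits_iff hne (s ++ x.take i)).2
      ⟨by rwa [hdrop], hi1⟩
    rw [Finset.sum_eq_single_of_mem y hy, Finset.sum_eq_single_of_mem i
      (Finset.mem_Icc.2 ⟨hi0, hil⟩)]
    · rw [Set.indicator_of_mem hs, Set.indicator_of_mem (by exact hyu)]
    · intro j hj hji
      refine Set.indicator_of_notMem (fun hj' => ?_) _
      have hj' : s ++ x.take j ∈ firstHits X y := hj'
      rcases lt_or_gt_of_ne hji with h | h
      · exact firstHits_notMem_avoiders hy hj' (not_not.1 (Nat.find_min hex h))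
      · exact hi1 (avoiders_antitone
          (prefix_dropLast_append_take h (Finset.mem_Icc.1 hj).2).isInfix hj'.2)
    · intro z hz hzy
      refine Finset.sum_eq_zero fun j hj => Set.indicator_of_notMem (fun hj' => ?_) _
      have hj' : s ++ x.take j ∈ firstHits X z := hj'
      rcases lt_trichotomy j i with h | h | h
      · exact firstHits_notMem_avoiders hz hj' (not_not.1 (Nat.find_min hex h))
      · rw [h] at hj'
        exact hzy (mem_firstHits_unique hX hz hy hj' hyu)
      · exact hi1 (avoiders_antitone
          (prefix_dropLast_append_take h (Finset.mem_Icc.1 hj).2).isInfix hj'.2)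
  · rw [Set.indicator_of_notMem hs]
    refine (Finset.sum_eq_zero fun y _ => Finset.sum_eq_zero fun i hi =>
      Set.indicator_of_notMem (fun h => hs ?_) _).symm
    have h : s ++ x.take i ∈ firstHits X y := h
    have hi := Finset.mem_Icc.1 hi
    have h1 := prefix_dropLast_append_take (s := s) (show 0 < i by omega) hi.2
    rw [List.take_zero, List.append_nil] at h1
    exact avoiders_antitone h1.isInfix h.2

end Combinatorics

section Identities

variable {p : ℝ} (hp : p ∈ Set.Ioo (0 : ℝ) 1) {X : Finset (List Bool)}
  (hX : ∀ x ∈ X, ∀ y ∈ X, x <:+: y → x = y) (hne : ∀ x ∈ X, x ≠ [])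
include hp hX hne

/-- Conway's linear relation between the first-hit weights and the weight of the avoiders. -/
theorem mass_avoiders_eq {x : List Bool} (hx : x ∈ X) :
    mass p (avoiders X) = ∑ y ∈ X, mass p (firstHits X y) * ecorr p y x := by
  conv_lhs => unfold mass
  simp_rw [sum_firstHits_indicator hX hne hx]
  rw [Summable.tsum_finsetSum fun _ _ => ENNReal.summable]
  refine Finset.sum_congr rfl fun y hy => ?_
  rw [Summable.tsum_finsetSum fun _ _ => ENNReal.summable, ecorr, Finset.mul_sum]
  refine Finset.sum_congr rfl fun i _ => ?_
  refine (mass_strip_suffix hp (firstHits X y) (x.take i)).trans ?_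
  split_ifs with h
  · congr 2
    ext u
    exact ⟨fun hu => hu.1, fun hu => ⟨hu, h.trans hu.1⟩⟩
  · rw [mul_zero, mul_eq_zero]
    left
    convert (by simp [mass] : mass p ∅ = 0)
    ext u
    simp only [Set.mem_ofPred_eq, Set.mem_empty_iff_false, iff_false]
    rintro ⟨hu, hxu⟩
    rcases List.suffix_or_suffix_of_suffix hxu hu.1 with h' | h'
    · exact h h'
    · have hpre := List.take_prefix i x
      obtain rfl := hX y hy x hx (h'.isInfix.trans hpre.isInfix)
      exact h ⟨[], (h'.eq_of_length_le hpre.length_le).symm⟩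

omit hp in
theorem sum_mass_firstHits :
    ∑ y ∈ X, mass p (firstHits X y) =
      mass p {u | u.dropLast ∈ avoiders X ∧ u ∉ avoiders X} := by
  classical
  unfold mass
  rw [← Summable.tsum_finsetSum fun _ _ => ENNReal.summable]
  refine tsum_congr fun u => ?_
  by_cases hu : u.dropLast ∈ avoiders X ∧ u ∉ avoiders X
  · obtain ⟨y, hy, hyu⟩ := (exists_mem_firstHits_iff hne u).2 hu
    rw [Set.indicator_of_mem (by exact hu), Finset.sum_eq_single_of_mem y hy,
      Set.indicator_of_mem hyu]
    exact fun z hz hzy => Set.indicator_of_notMem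
      (fun h => hzy (mem_firstHits_unique hX hz hy h hyu)) _
  · rw [Set.indicator_of_notMem (by exact hu)]
    exact Finset.sum_eq_zero fun y hy => Set.indicator_of_notMem
      (fun h => hu ((exists_mem_firstHits_iff hne u).1 ⟨y, hy, h⟩)) _

theorem mass_firstHits_ne_top {y : List Bool} (hy : y ∈ X) : mass p (firstHits X y) ≠ ∞ := by
  have h := mass_leaves_le_one hp (nil_mem_avoiders hne) fun u hu =>
    avoiders_antitone (List.dropLast_prefix u).isInfix hu
  rw [← sum_mass_firstHits hX hne] at h
  exact ne_top_of_le_ne_top ENNReal.one_ne_top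
    ((Finset.single_le_sum (f := fun y => mass p (firstHits X y)) (fun _ _ => zero_le) hy).trans h)

theorem mass_avoiders_ne_top (hXn : X.Nonempty) : mass p (avoiders X) ≠ ∞ := by
  obtain ⟨x, hx⟩ := hXn
  rw [mass_avoiders_eq hp hX hne hx]
  exact ENNReal.sum_ne_top.2 fun y hy =>
    ENNReal.mul_ne_top (mass_firstHits_ne_top hp hX hne hy) (ecorr_ne_top hp y x)

/-- Almost surely some element of `X` occurs. -/
theorem sum_mass_firstHits_eq_one (hXn : X.Nonempty) :
    ∑ y ∈ X, mass p (firstHits X y) = 1 := by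
  rw [sum_mass_firstHits hX hne]
  exact mass_leaves hp (nil_mem_avoiders hne)
    (fun u hu => avoiders_antitone (List.dropLast_prefix u).isInfix hu)
    (mass_avoiders_ne_top hp hX hne hXn)

end Identities

theorem mass_avoiders_singleton {p : ℝ} (hp : p ∈ Set.Ioo (0 : ℝ) 1) {v : List Bool}
    (hv : v ≠ []) : mass p (avoiders {v}) = ecorr p v v := by
  have hX : ∀ x ∈ ({v} : Finset (List Bool)), ∀ y ∈ ({v} : Finset (List Bool)),
      x <:+: y → x = y := by
    simp
  have hne : ∀ x ∈ ({v} : Finset (List Bool)), x ≠ [] := by simpa using hv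
  have h1 := mass_avoiders_eq hp hX hne (Finset.mem_singleton_self v)
  have h2 := sum_mass_firstHits_eq_one hp hX hne (Finset.singleton_nonempty v)
  rw [Finset.sum_singleton] at h1 h2
  rw [h1, h2, one_mul]

theorem mass_avoiders_pair_lt {p : ℝ} (hp : p ∈ Set.Ioo (0 : ℝ) 1) {v w : List Bool}
    (hv : v ≠ []) (hvw : ¬ v <:+: w) : mass p (avoiders {v, w}) < ecorr p v v := by
  rw [← mass_avoiders_singleton hp hv]
  have hsub : avoiders {v, w} ∪ {w} ⊆ avoiders {v} := by
    rintro u (hu | rfl)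
    · intro y hy
      exact hu y (by simp_all)
    · intro y hy
      rwa [Finset.mem_singleton.1 hy]
  have hdisj : Disjoint (avoiders {v, w}) {w} :=
    Set.disjoint_singleton_right.2 fun h => h w (by simp) List.infix_rfl
  have hle := mass_mono (p := p) hsub
  rw [mass_union hdisj, mass_singleton] at hle
  have hfin : mass p (avoiders {v, w}) ≠ ∞ := by
    refine ne_top_of_le_ne_top ?_ (le_self_add.trans hle)
    rw [mass_avoiders_singleton hp hv]
    exact ecorr_ne_top hp v v
  exact (ENNReal.lt_add_right hfin (wt_ne_zero hp w)).trans_le hle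

/-- A word has exactly one occurrence of its suffix `v` iff `v` does not occur before the last
letter. -/
theorem occCount_eq_one_iff {v u : List Bool} (hv : v ≠ []) (h : v <:+ u) :
    occCount v u = 1 ↔ ¬ v <:+: u.dropLast := by
  have hvl : 0 < v.length := List.length_pos_iff.2 hv
  have hle := h.length_le
  have hocc : occCount v u = ((Finset.range (u.length + 1)).filter fun i => v <+: u.drop i).card := by
    rw [occCount, List.countP_eq_length_filter]
    rfl
  have hend : u.length - v.length ∈ (Finset.range (u.length + 1)).filter fun i => v <+: u.drop i := by
    simp only [Finset.mem_filter, Finset.mem_range]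
    refine ⟨by omega, ?_⟩
    rw [← List.suffix_iff_eq_drop.1 h]
  rw [hocc]
  constructor
  · rintro h1 ⟨s, t, hst⟩
    obtain ⟨a, ha⟩ := Finset.card_eq_one.1 h1
    have hu : u ≠ [] := by rintro rfl; exact hv (List.suffix_nil.1 h)
    have hus : u = s ++ (v ++ (t ++ [u.getLast hu])) := by
      conv_lhs => rw [← List.dropLast_append_getLast hu, ← hst]
      simp
    have hlen := congrArg List.length hus
    simp only [List.length_append, List.length_singleton] at hlen
    have hs : s.length ∈ (Finset.range (u.length + 1)).filter fun i => v <+: u.drop i := by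
      simp only [Finset.mem_filter, Finset.mem_range]
      refine ⟨by omega, ?_⟩
      rw [hus, List.drop_left]
      exact List.prefix_append _ _
    rw [ha, Finset.mem_singleton] at hs hend
    omega
  · intro h1
    refine Finset.card_eq_one.2 ⟨_, Finset.eq_singleton_iff_unique_mem.2 ⟨hend, fun i hi => ?_⟩⟩
    simp only [Finset.mem_filter, Finset.mem_range] at hi
    have hil := hi.2.length_le
    rw [List.length_drop] at hil
    by_contra hne
    apply h1
    have hpre : v <+: (u.drop i).take (u.length - 1 - i) :=
      List.prefix_take_iff.2 ⟨hi.2, by omega⟩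
    rw [List.dropLast_eq_take]
    rw [← List.drop_take] at hpre
    exact hpre.isInfix.trans (List.drop_suffix _ _).isInfix

theorem OmegaWin_eq_firstHits {v w : List Bool} (hv : v ≠ [])
    (hvw : ¬ v <:+: w) (hwv : ¬ w <:+: v) : OmegaWin v w = firstHits {v, w} v := by
  ext u
  simp only [OmegaWin, firstHits, avoiders, Set.mem_ofPred_eq, Finset.mem_insert,
    Finset.mem_singleton, forall_eq_or_imp, forall_eq]
  refine and_congr_right fun h => ?_
  rw [occCount_eq_one_iff hv h]
  refine and_congr_right fun _ => not_congr ⟨fun hw => ?_, fun hw =>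
    hw.trans (List.dropLast_prefix u).isInfix⟩
  have hu : u ≠ [] := by rintro rfl; exact hv (List.suffix_nil.1 h)
  rw [← List.dropLast_append_getLast hu, List.infix_concat_iff,
    List.dropLast_append_getLast hu] at hw
  refine hw.resolve_left fun hw => ?_
  rcases List.suffix_or_suffix_of_suffix hw h with h' | h'
  · exact hwv h'.isInfix
  · exact hvw h'.isInfix

theorem Win_eq_toReal_mass {p : ℝ} (hp : p ∈ Set.Ioo (0 : ℝ) 1) (v w : List Bool) :
    Win v w p = (mass p (OmegaWin v w)).toReal := by
  rw [Win, mass, ← tsum_subtype, ENNReal.tsum_toReal_eq fun _ => wt_ne_top _]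
  exact tsum_congr fun u => (ENNReal.toReal_ofReal (wProb_pos hp _).le).symm

/-- Conway's formula for the win probability. -/
theorem stmt0 (v w : List Bool) (hv : v ≠ []) (hw : w ≠ [])
    (hvw : ¬ v <:+: w) (hwv : ¬ w <:+: v) (p : ℝ) (hp : p ∈ Set.Ioo (0:ℝ) 1) :
    corr w w p + corr v v p - corr w v p - corr v w p ≠ 0 ∧
    Win v w p =
      (corr w w p - corr w v p) /
        (corr w w p + corr v v p - corr w v p - corr v w p) := by
  have hX : ∀ x ∈ ({v, w} : Finset (List Bool)), ∀ y ∈ ({v, w} : Finset (List Bool)),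
      x <:+: y → x = y := by
    simp [hvw, hwv]
  have hne : ∀ x ∈ ({v, w} : Finset (List Bool)), x ≠ [] := by simp [hv, hw]
  have hvw' : v ≠ w := by rintro rfl; exact hvw List.infix_rfl
  have hmv : v ∈ ({v, w} : Finset (List Bool)) := by simp
  have hmw : w ∈ ({v, w} : Finset (List Bool)) := by simp
  have e1 := mass_avoiders_eq hp hX hne hmv
  have e2 := mass_avoiders_eq hp hX hne hmw
  have e3 := sum_mass_firstHits_eq_one hp hX hne ⟨v, hmv⟩
  have l1 := mass_avoiders_pair_lt hp hv hvw
  have l2 := mass_avoiders_pair_lt hp hw hwv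
  rw [Finset.pair_comm w v] at l2
  rw [Win_eq_toReal_mass hp, OmegaWin_eq_firstHits hv hvw hwv]
  have fa := mass_firstHits_ne_top hp hX hne hmv
  have fb := mass_firstHits_ne_top hp hX hne hmw
  have r1 := ENNReal.toReal_strict_mono (ecorr_ne_top hp v v) l1
  have r2 := ENNReal.toReal_strict_mono (ecorr_ne_top hp w w) l2
  replace e1 := congrArg ENNReal.toReal e1
  replace e2 := congrArg ENNReal.toReal e2
  replace e3 := congrArg ENNReal.toReal e3
  rw [Finset.sum_pair hvw', ENNReal.toReal_add (ENNReal.mul_ne_top fa (ecorr_ne_top hp _ _))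
    (ENNReal.mul_ne_top fb (ecorr_ne_top hp _ _)), ENNReal.toReal_mul, ENNReal.toReal_mul] at e1 e2
  rw [Finset.sum_pair hvw', ENNReal.toReal_add fa fb, ENNReal.toReal_one] at e3
  simp only [toReal_ecorr hp] at e1 e2 r1 r2
  have ha := ENNReal.toReal_nonneg (a := mass p (firstHits {v, w} v))
  have hb := ENNReal.toReal_nonneg (a := mass p (firstHits {v, w} w))
  generalize (mass p (firstHits {v, w} v)).toReal = a at *
  generalize (mass p (firstHits {v, w} w)).toReal = b at *
  generalize (mass p (avoiders {v, w})).toReal = s at *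
  obtain rfl : b = 1 - a := by linarith
  have key : a * (corr w w p + corr v v p - corr w v p - corr v w p) =
      corr w w p - corr w v p := by linarith
  have hD : corr w w p + corr v v p - corr w v p - corr v w p ≠ 0 := by
    intro h
    rw [h, mul_zero] at key
    have hwv_eq : corr w v p = corr w w p := by linarith
    rw [hwv_eq] at e1
    rcases ha.eq_or_lt with h0 | h0
    · rw [← h0] at e1
      linarith
    · linarith [mul_lt_mul_of_pos_left r1 h0, mul_le_mul_of_nonneg_left r2.le hb]
  exact ⟨hD, eq_div_of_mul_eq hD key⟩
end

section
/- (Forward propagation) Let v = v₁⋯v_n be a binary word of length n, and let P = {n − i : 1 ≤ i ≤ n and v₁⋯v_i ∈ O(v,v)} ⊆ ℕ. Then for all s, t ∈ P with s + t < n, also s + t ∈ P. -/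
open scoped BigOperators

theorem List.take_suffix_iff_drop_prefix {α : Type*} {l : List α} {i : ℕ} (hi : i ≤ l.length) :
    l.take i <:+ l ↔ l.drop (l.length - i) <+: l := by
  rw [List.suffix_iff_eq_drop, List.prefix_iff_eq_take, List.length_take, List.length_drop,
    Nat.min_eq_left hi, Nat.sub_sub_self hi, eq_comm]

theorem List.drop_add_prefix {α : Type*} {l : List α} {s t : ℕ}
    (hs : l.drop s <+: l) (ht : l.drop t <+: l) : l.drop (s + t) <+: l := by
  rw [← List.drop_drop]
  exact (hs.drop t).trans ht

/-- Forward propagation: the set `{n - i : v₁⋯v_i ∈ O(v,v)}` is closed under addition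
(below `n`). -/
theorem stmt2 (v : List Bool) (hv : v ≠ []) (s t : ℕ)
    (hs : ∃ i, 1 ≤ i ∧ i ≤ v.length ∧ v.take i <:+ v ∧ s = v.length - i)
    (ht : ∃ i, 1 ≤ i ∧ i ≤ v.length ∧ v.take i <:+ v ∧ t = v.length - i)
    (hst : s + t < v.length) :
    ∃ i, 1 ≤ i ∧ i ≤ v.length ∧ v.take i <:+ v ∧ s + t = v.length - i := by
  obtain ⟨i, -, hi, hiv, rfl⟩ := hs
  obtain ⟨j, -, hj, hjv, rfl⟩ := ht
  rw [List.take_suffix_iff_drop_prefix hi] at hiv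
  rw [List.take_suffix_iff_drop_prefix hj] at hjv
  refine ⟨v.length - (v.length - i + (v.length - j)), by omega, by omega, ?_, by omega⟩
  rw [List.take_suffix_iff_drop_prefix (Nat.sub_le _ _), Nat.sub_sub_self hst.le]
  exact List.drop_add_prefix hiv hjv
end

section
/- Let w be a binary word of length n ≥ 1 and let v be a binary word of length n + 1 that does not contain w as a subword. If Win(v,w;1/2) ≥ 1/2, then w = 1^n or w = 0^n (i.e., w is a constant word). -/
open scoped BigOperators

open scoped ENNReal

theorem occCount_concat_eq_one_iff {a q : List Bool} {c : Bool} (ha : a ≠ [])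
    (h : a <:+ q ++ [c]) : occCount a (q ++ [c]) = 1 ↔ ¬ a <:+: q := by
  have hcard : occCount a (q ++ [c]) =
      ((Finset.range ((q ++ [c]).length + 1)).filter (fun i => a <+: (q ++ [c]).drop i)).card := by
    rw [occCount, List.countP_eq_length_filter]
    rfl
  have hpos : 0 < a.length := List.length_pos_iff.2 ha
  have hle : a.length ≤ q.length + 1 := by simpa using h.length_le
  have hlast : a <+: (q ++ [c]).drop (q.length + 1 - a.length) := by
    have := List.suffix_iff_eq_drop.1 h
    simp only [List.length_append, List.length_singleton] at this
    rw [← this]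
  rw [hcard, Finset.card_eq_one]
  constructor
  · rintro ⟨i, hi⟩ ⟨s, t, hst⟩
    have hlen : s.length + a.length + t.length = q.length := by
      simp [← hst, add_assoc]
    have h₁ : s.length ∈ ({i} : Finset ℕ) := by
      rw [← hi, Finset.mem_filter, Finset.mem_range]
      refine ⟨by simp; omega, t ++ [c], ?_⟩
      simp [← hst]
    have h₂ : q.length + 1 - a.length ∈ ({i} : Finset ℕ) := by
      rw [← hi, Finset.mem_filter, Finset.mem_range]
      exact ⟨by simp, hlast⟩
    rw [Finset.mem_singleton] at h₁ h₂
    omega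
  · intro hq
    refine ⟨q.length + 1 - a.length, ?_⟩
    ext i
    rw [Finset.mem_filter, Finset.mem_range, Finset.mem_singleton]
    constructor
    · rintro ⟨-, hi⟩
      have hil : a.length ≤ q.length + 1 - i := by simpa using hi.length_le
      by_contra hne
      refine hq ?_
      have hiq : i ≤ q.length := by omega
      rw [List.drop_append_of_le_length hiq] at hi
      exact (List.prefix_of_prefix_length_le hi (List.prefix_append _ _)
        (by simp; omega)).isInfix.trans (List.drop_suffix _ _).isInfix
    · rintro rfl
      exact ⟨by simp, hlast⟩

theorem concat_mem_OmegaWin_iff {a b : List Bool} (hab : ¬ a <:+: b) (hba : ¬ b <:+: a)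
    (q : List Bool) (c : Bool) :
    q ++ [c] ∈ OmegaWin a b ↔ a <:+ q ++ [c] ∧ ¬ a <:+: q ∧ ¬ b <:+: q := by
  have ha : a ≠ [] := by
    rintro rfl
    simp at hab
  simp only [OmegaWin, Set.mem_ofPred_eq]
  refine and_congr_right fun h => ?_
  rw [occCount_concat_eq_one_iff ha h, List.infix_concat_iff]
  refine and_congr_right fun _ => not_congr ⟨?_, Or.inr⟩
  rintro (hb | hb)
  · rcases List.suffix_or_suffix_of_suffix h hb with hs | hs
    · exact absurd hs.isInfix hab
    · exact absurd hs.isInfix hba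
  · exact hb

/-- Words containing neither `a` nor `b`. -/
def avoiding (a b : List Bool) : Set (List Bool) :=
  {u | ¬ a <:+: u ∧ ¬ b <:+: u}

theorem avoiding_comm (a b : List Bool) : avoiding a b = avoiding b a :=
  Set.ext fun _ => and_comm

/-- The weight of a word under fair coin tosses. -/
noncomputable def fairWeight (u : List Bool) : ℝ≥0∞ := 2⁻¹ ^ u.length

/-- The fair-coin measure of a set of words. -/
noncomputable def fairSum (S : Set (List Bool)) : ℝ≥0∞ :=
  ∑' u, S.indicator 1 u * fairWeight u

theorem avoiding_indicator_step {a b : List Bool} (hab : ¬ a <:+: b) (hba : ¬ b <:+: a)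
    (q : List Bool) (c : Bool) :
    (avoiding a b).indicator (1 : List Bool → ℝ≥0∞) q =
      (OmegaWin a b).indicator 1 (q ++ [c]) + (OmegaWin b a).indicator 1 (q ++ [c]) +
        (avoiding a b).indicator 1 (q ++ [c]) := by
  classical
  have h₁ := concat_mem_OmegaWin_iff hab hba q c
  have h₂ := concat_mem_OmegaWin_iff hba hab q c
  have h₃ : q ++ [c] ∈ avoiding a b ↔
      (¬ a <:+ q ++ [c] ∧ ¬ a <:+: q) ∧ (¬ b <:+ q ++ [c] ∧ ¬ b <:+: q) := by
    simp only [avoiding, Set.mem_ofPred_eq, List.infix_concat_iff, not_or]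
  have h₄ : ¬ (a <:+ q ++ [c] ∧ b <:+ q ++ [c]) := by
    rintro ⟨ha, hb⟩
    rcases List.suffix_or_suffix_of_suffix ha hb with hs | hs
    · exact hab hs.isInfix
    · exact hba hs.isInfix
  simp only [Set.indicator_apply, h₁, h₂, h₃, Pi.one_apply]
  simp only [avoiding, Set.mem_ofPred_eq]
  by_cases ha : a <:+ q ++ [c] <;> by_cases hb : b <:+ q ++ [c] <;>
    by_cases ha' : a <:+: q <;> by_cases hb' : b <:+: q <;> simp_all

theorem avoiding_indicator_eq_sum {a b : List Bool} (hab : ¬ a <:+: b) (hba : ¬ b <:+: a)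
    (u t : List Bool) {m : ℕ} (hm : m ≤ t.length) :
    (avoiding a b).indicator (1 : List Bool → ℝ≥0∞) u =
      ∑ k ∈ Finset.Icc 1 m, ((OmegaWin a b).indicator 1 (u ++ t.take k) +
        (OmegaWin b a).indicator 1 (u ++ t.take k)) +
        (avoiding a b).indicator 1 (u ++ t.take m) := by
  induction m with
  | zero => simp
  | succ m ih =>
    rw [ih (by omega), Finset.sum_Icc_succ_top (by omega), add_assoc,
      avoiding_indicator_step hab hba _ (t[m]), List.append_assoc, List.take_concat_get']

theorem tsum_indicator_append {x y t : List Bool} (h : x <:+ t → t <:+ x) [Decidable (t <:+ x)] :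
    ∑' u, (OmegaWin x y).indicator 1 (u ++ t) * fairWeight u =
      fairSum (OmegaWin x y) * ((if t <:+ x then 2 ^ t.length else 0 : ℕ) : ℝ≥0∞) := by
  split_ifs with ht
  · have hinj : Function.Injective (fun u : List Bool => u ++ t) :=
      fun _ _ => List.append_cancel_right
    rw [fairSum, ← ENNReal.tsum_mul_right]
    rw [← hinj.tsum_eq (f := fun p => (OmegaWin x y).indicator 1 p * fairWeight p * _)]
    · refine tsum_congr fun u => ?_
      have : fairWeight u = fairWeight (u ++ t) * 2 ^ t.length := by
        simp only [fairWeight, List.length_append, pow_add, mul_assoc]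
        rw [← mul_pow, ENNReal.inv_mul_cancel (by simp) (by simp)]
        simp
      rw [this]
      push_cast
      ring
    · intro p hp
      have hmem : p ∈ OmegaWin x y := by
        by_contra hp'
        simp [hp'] at hp
      obtain ⟨u, hu⟩ := ht.trans hmem.1
      exact ⟨u, hu⟩
  · simp only [Nat.cast_zero, mul_zero, ENNReal.tsum_eq_zero]
    intro u
    have : u ++ t ∉ OmegaWin x y := by
      intro hu
      rcases List.suffix_or_suffix_of_suffix hu.1 (List.suffix_append u t) with hs | hs
      · exact ht (h hs)
      · exact ht hs
    simp [this]

/-- The fair-coin correlation, in the normalization where an overlap of length `k` counts `2 ^ k`. -/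
def overlapSum (x y : List Bool) : ℕ :=
  ∑ k ∈ Finset.Icc 1 y.length, if y.take k <:+ x then 2 ^ k else 0

/-- Conway's linear equation for the two win probabilities. -/
theorem fairSum_avoiding {a b : List Bool} (hab : ¬ a <:+: b) (hba : ¬ b <:+: a) :
    fairSum (avoiding a b) = fairSum (OmegaWin a b) * overlapSum a a +
      fairSum (OmegaWin b a) * overlapSum b a := by
  have hpt : ∀ u, (avoiding a b).indicator (1 : List Bool → ℝ≥0∞) u * fairWeight u =
      ∑ k ∈ Finset.Icc 1 a.length, ((OmegaWin a b).indicator 1 (u ++ a.take k) * fairWeight u +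
        (OmegaWin b a).indicator 1 (u ++ a.take k) * fairWeight u) := by
    intro u
    have hnot : u ++ a ∉ avoiding a b := fun h => h.1 (List.suffix_append u a).isInfix
    rw [avoiding_indicator_eq_sum hab hba u a le_rfl, List.take_length,
      Set.indicator_of_notMem hnot, add_zero, Finset.sum_mul]
    simp only [add_mul]
  rw [fairSum, tsum_congr hpt, Summable.tsum_finsetSum fun _ _ => ENNReal.summable, overlapSum,
    overlapSum, Nat.cast_sum, Nat.cast_sum, Finset.mul_sum, Finset.mul_sum,
    ← Finset.sum_add_distrib]
  refine Finset.sum_congr rfl fun k hk => ?_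
  have hk' : (a.take k).length = k := by
    rw [List.length_take, min_eq_left (Finset.mem_Icc.1 hk).2]
  rw [ENNReal.tsum_add, tsum_indicator_append, tsum_indicator_append, hk']
  · exact fun h => absurd (h.isInfix.trans ⟨[], a.drop k, by simp⟩) hba
  · intro h
    rw [← h.eq_of_length_le (by simp)]

theorem uniquelyDecodable_of_prefix_free {α : Type*} {S : Set (List α)} (hnil : [] ∉ S)
    (hS : ∀ x ∈ S, ∀ y ∈ S, x <+: y → x = y) : InformationTheory.UniquelyDecodable S := by
  intro L₁
  induction L₁ with
  | nil =>
    rintro (_ | ⟨y, L₂⟩) - h₂ h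
    · rfl
    · have : y = [] := by simp_all
      exact absurd (this ▸ h₂ y (by simp)) hnil
  | cons x L₁ ih =>
    rintro (_ | ⟨y, L₂⟩) h₁ h₂ h
    · have : x = [] := by simp_all
      exact absurd (this ▸ h₁ x (by simp)) hnil
    · rw [List.flatten_cons, List.flatten_cons] at h
      have hx := h₁ x (by simp)
      have hy := h₂ y (by simp)
      have hxy : x = y := by
        have hpx := List.prefix_append x L₁.flatten
        have hpy : y <+: x ++ L₁.flatten := h ▸ List.prefix_append y L₂.flatten
        rcases le_total x.length y.length with hl | hl
        · exact hS x hx y hy (List.prefix_of_prefix_length_le hpx hpy hl)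
        · exact (hS y hy x hx (List.prefix_of_prefix_length_le hpy hpx hl)).symm
      subst hxy
      rw [ih L₂ (fun w hw => h₁ w (by simp [hw])) (fun w hw => h₂ w (by simp [hw]))
        (List.append_cancel_left h)]

theorem fairSum_le_one {S : Set (List Bool)} (hS : InformationTheory.UniquelyDecodable S) :
    fairSum S ≤ 1 := by
  classical
  rw [fairSum, ENNReal.tsum_eq_iSup_sum]
  refine iSup_le fun T => ?_
  have hT : InformationTheory.UniquelyDecodable (T.filter (· ∈ S) : Set (List Bool)) := by
    intro L₁ L₂ h₁ h₂
    exact hS L₁ L₂ (fun w hw => (Finset.mem_filter.1 (h₁ w hw)).2)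
      (fun w hw => (Finset.mem_filter.1 (h₂ w hw)).2)
  have key := InformationTheory.kraft_mcmillan_inequality hT
  calc ∑ u ∈ T, S.indicator 1 u * fairWeight u
      = ∑ u ∈ T with u ∈ S, fairWeight u := by
        rw [Finset.sum_filter]
        refine Finset.sum_congr rfl fun u _ => ?_
        by_cases hu : u ∈ S <;> simp [hu]
    _ = ENNReal.ofReal (∑ u ∈ T with u ∈ S, (1 / Fintype.card Bool : ℝ) ^ u.length) := by
        rw [ENNReal.ofReal_sum_of_nonneg fun _ _ => by positivity]
        refine Finset.sum_congr rfl fun u _ => ?_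
        rw [fairWeight, ENNReal.ofReal_pow (by positivity), Fintype.card_bool, one_div,
          ENNReal.ofReal_inv_of_pos (by norm_num)]
        simp
    _ ≤ 1 := by simpa using ENNReal.ofReal_le_ofReal key

theorem fairSum_OmegaWin_add_le_one {a b : List Bool} (hab : ¬ a <:+: b) (hba : ¬ b <:+: a) :
    fairSum (OmegaWin a b) + fairSum (OmegaWin b a) ≤ 1 := by
  have hmem : ∀ q c, q ++ [c] ∈ OmegaWin a b ∪ OmegaWin b a ↔
      (a <:+ q ++ [c] ∨ b <:+ q ++ [c]) ∧ q ∈ avoiding a b := by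
    intro q c
    rw [Set.mem_union, concat_mem_OmegaWin_iff hab hba, concat_mem_OmegaWin_iff hba hab]
    simp only [avoiding, Set.mem_ofPred_eq]
    tauto
  have hhit : ∀ p ∈ OmegaWin a b ∪ OmegaWin b a, a <:+ p ∨ b <:+ p :=
    fun p hp => hp.imp And.left And.left
  have hnil : [] ∉ OmegaWin a b ∪ OmegaWin b a := by
    intro h
    rcases hhit [] h with h | h
    · simp [List.suffix_nil.1 h] at hab
    · simp [List.suffix_nil.1 h] at hba
  have hdisj : Disjoint (OmegaWin a b) (OmegaWin b a) :=
    Set.disjoint_left.2 fun p hp hp' => hp.2.2 hp'.1.isInfix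
  have hadd : fairSum (OmegaWin a b) + fairSum (OmegaWin b a) =
      fairSum (OmegaWin a b ∪ OmegaWin b a) := by
    rw [fairSum, fairSum, fairSum, ← ENNReal.tsum_add]
    refine tsum_congr fun u => ?_
    rw [Set.indicator_union_of_disjoint hdisj, add_mul]
  rw [hadd]
  refine fairSum_le_one (uniquelyDecodable_of_prefix_free hnil fun x hx y hy hxy => ?_)
  rcases List.eq_nil_or_concat' y with rfl | ⟨q, c, rfl⟩
  · exact absurd hy hnil
  · rcases List.prefix_concat_iff.1 hxy with h | h
    · exact h
    · have hq := ((hmem q c).1 hy).2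
      rcases hhit x hx with hs | hs
      · exact absurd (hs.isInfix.trans h.isInfix) hq.1
      · exact absurd (hs.isInfix.trans h.isInfix) hq.2

theorem Win_half (v w : List Bool) : Win v w (1 / 2) = (fairSum (OmegaWin v w)).toReal := by
  have h : ∀ u, wProb (1 / 2) u = (fairWeight u).toReal := by
    intro u
    rw [wProb, fairWeight, ENNReal.toReal_pow, ← List.count_true_add_count_false u, pow_add]
    norm_num
  have hsum : fairSum (OmegaWin v w) = ∑' u : OmegaWin v w, fairWeight u := by
    rw [tsum_subtype, fairSum]
    refine tsum_congr fun u => ?_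
    by_cases hu : u ∈ OmegaWin v w <;> simp [hu]
  rw [Win, hsum, ENNReal.tsum_toReal_eq fun u => by simp [fairWeight]]
  exact tsum_congr fun u => h u

theorem overlapSum_le_of_half_le_Win {v w : List Bool} (hvw : ¬ v <:+: w) (hwv : ¬ w <:+: v)
    (hlt : overlapSum v w < overlapSum v v) (hwin : 1 / 2 ≤ Win v w (1 / 2)) :
    overlapSum v v + overlapSum w v ≤ overlapSum w w + overlapSum v w := by
  have hle := fairSum_OmegaWin_add_le_one hvw hwv
  have hv : fairSum (OmegaWin v w) ≠ ∞ :=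
    ne_top_of_le_ne_top ENNReal.one_ne_top (le_self_add.trans hle)
  have hw : fairSum (OmegaWin w v) ≠ ∞ :=
    ne_top_of_le_ne_top ENNReal.one_ne_top (le_add_self.trans hle)
  have heq := (fairSum_avoiding hvw hwv).symm.trans
    ((congrArg fairSum (avoiding_comm v w)).trans (fairSum_avoiding hwv hvw))
  rw [Win_half] at hwin
  lift fairSum (OmegaWin v w) to NNReal using hv with x
  lift fairSum (OmegaWin w v) to NNReal using hw with y
  have hle' : (x : ℝ) + y ≤ 1 := by exact_mod_cast hle
  have heq' : (x : ℝ) * overlapSum v v + y * overlapSum w v =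
      y * overlapSum w w + x * overlapSum v w := by exact_mod_cast heq
  have hwin' : (1 / 2 : ℝ) ≤ x := hwin
  have hlt' : (overlapSum v w : ℝ) < overlapSum v v := by exact_mod_cast hlt
  have hy : (0 : ℝ) ≤ y := y.2
  rw [← Nat.cast_le (α := ℝ)]
  push_cast
  by_contra! h
  have h₁ : 0 ≤ (1 / 2 - y : ℝ) * (overlapSum v v - overlapSum v w) :=
    mul_nonneg (by linarith) (by linarith)
  have h₂ : 0 ≤ (x - 1 / 2 : ℝ) * (overlapSum v v - overlapSum v w) :=
    mul_nonneg (by linarith) (by linarith)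
  have h₃ : 0 ≤ (y : ℝ) * (overlapSum v v + overlapSum w v - (overlapSum w w + overlapSum v w)) :=
    mul_nonneg hy (by linarith)
  have h₄ : (y : ℝ) *
      (overlapSum v v + overlapSum w v - (overlapSum w w + overlapSum v w)) = 0 := by
    linarith
  rcases mul_eq_zero.1 h₄ with h₅ | h₅
  · rw [h₅] at heq'
    have := mul_pos (show (0 : ℝ) < x by linarith) (sub_pos.2 hlt')
    linarith
  · linarith

theorem sum_two_pow_Icc_one (m : ℕ) : ∑ k ∈ Finset.Icc 1 m, 2 ^ k + 2 = 2 ^ (m + 1) := by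
  induction m with
  | zero => simp
  | succ m ih =>
    rw [Finset.sum_Icc_succ_top (by omega), pow_succ 2 (m + 1)]
    omega

theorem three_mul_sum_two_pow_same_parity (m : ℕ) :
    3 * (∑ k ∈ Finset.Icc 1 m, if Even (m + k) then 2 ^ k else 0) + 2 ≤ 4 * 2 ^ m := by
  induction m using Nat.twoStepInduction with
  | zero => simp
  | one => simp
  | more m ih _ =>
    rw [Finset.sum_Icc_succ_top (by omega), Finset.sum_Icc_succ_top (by omega),
      if_neg (by rw [Nat.not_even_iff]; omega), if_pos (by rw [Nat.even_iff]; omega)]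
    have : ∀ k, Even (m + 2 + k) ↔ Even (m + k) := fun k => by
      rw [Nat.even_iff, Nat.even_iff]; omega
    simp only [this, pow_succ] at ih ⊢
    omega

theorem overlapSum_of_le {x y : List Bool} {j : ℕ} (hj : j ≤ y.length)
    (h : ∀ k, j < k → k ≤ y.length → ¬ y.take k <:+ x) :
    overlapSum x y = ∑ k ∈ Finset.Icc 1 j, if y.take k <:+ x then 2 ^ k else 0 := by
  refine (Finset.sum_subset (Finset.Icc_subset_Icc_right hj) fun k hk hk' => if_neg ?_).symm
  rw [Finset.mem_Icc] at hk hk'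
  exact h k (by omega) hk.2

theorem overlapSum_add_two_le {x y : List Bool} {j : ℕ} (hj : j ≤ y.length)
    (h : ∀ k, j < k → k ≤ y.length → ¬ y.take k <:+ x) :
    overlapSum x y + 2 ≤ 2 ^ (j + 1) := by
  rw [overlapSum_of_le hj h, ← sum_two_pow_Icc_one]
  gcongr
  split_ifs <;> simp

theorem two_pow_le_overlapSum_self {x : List Bool} (hx : x ≠ []) :
    2 ^ x.length ≤ overlapSum x x := by
  have hpos := List.length_pos_iff.2 hx
  have := Finset.single_le_sum (f := fun k => if x.take k <:+ x then 2 ^ k else 0)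
    (fun _ _ => Nat.zero_le _) (Finset.mem_Icc.2 ⟨hpos, le_refl x.length⟩)
  simpa [overlapSum] using this

/-- An overlap of a word with itself of length `k` makes the word `(|x| - k)`-periodic. -/
theorem getElem_eq_of_take_suffix {x : List Bool} {k : ℕ} (h : x.take k <:+ x) (i : ℕ)
    (hi : i < k) (hk : k ≤ x.length) : x[i] = x[x.length - k + i] := by
  have h' := List.suffix_iff_eq_drop.1 h
  rw [List.length_take, min_eq_left hk] at h'
  have h₁ : (x.take k)[i]? = (x.drop (x.length - k))[i]? := by rw [← h']
  rw [List.getElem?_take_of_lt hi, List.getElem?_drop, List.getElem?_eq_getElem (by omega),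
    List.getElem?_eq_getElem (by omega)] at h₁
  exact Option.some.inj h₁

theorem eq_replicate_of_take_suffix {x : List Bool} {k : ℕ} (h : x.take k <:+ x)
    (hk : k + 1 = x.length) : ∃ c, x = List.replicate x.length c := by
  have hstep : ∀ i (hi : i < x.length), x[i] = x[0] := by
    intro i
    induction i with
    | zero => exact fun _ => rfl
    | succ i ih =>
      intro hi
      rw [← ih (by omega), getElem_eq_of_take_suffix h i (by omega) (by omega)]
      congr 1
      omega
  refine ⟨x[0], List.ext_getElem (by simp) fun i hi _ => ?_⟩
  rw [hstep i hi, List.getElem_replicate]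

theorem three_mul_overlapSum_self_lt {x : List Bool} (hx : ∀ c, x ≠ List.replicate x.length c) :
    3 * overlapSum x x < 4 * 2 ^ x.length := by
  have hlen : 2 ≤ x.length := by
    by_contra! h
    match x, h with
    | [], _ => exact hx true rfl
    | [c], _ => exact hx c rfl
  obtain ⟨m, hm⟩ := Nat.exists_eq_add_of_le' hlen
  have hm1 : ¬ x.take (m + 1) <:+ x := fun h =>
    let ⟨c, hc⟩ := eq_replicate_of_take_suffix h hm.symm
    hx c hc
  by_cases hper : x.take m <:+ x ∧ m ≠ 0
  · have hparity : ∀ i (hi : i < x.length), x[i] = x[i % 2] := by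
      intro i
      induction i using Nat.twoStepInduction with
      | zero => exact fun _ => rfl
      | one => exact fun _ => rfl
      | more i ih _ =>
        intro hi
        have h := getElem_eq_of_take_suffix hper.1 i (by omega) (by omega)
        simp only [show x.length - m + i = i + 2 by omega] at h
        simp only [← h, ih (by omega), Nat.add_mod_right]
    have h01 : x[0] ≠ x[1] := by
      intro h
      refine hx x[0] (List.ext_getElem (by simp) fun i hi _ => ?_)
      rw [List.getElem_replicate, hparity i hi]
      rcases Nat.mod_two_eq_zero_or_one i with h' | h' <;> simp only [h', h]
    have hsub : overlapSum x x ≤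
        ∑ k ∈ Finset.Icc 1 x.length, if Even (x.length + k) then 2 ^ k else 0 := by
      refine Finset.sum_le_sum fun k hk => ?_
      rw [Finset.mem_Icc] at hk
      by_cases hkx : x.take k <:+ x
      · have h := getElem_eq_of_take_suffix hkx 0 (by omega) hk.2
        rw [hparity (x.length - k + 0)] at h
        have heven : Even (x.length + k) := by
          by_contra hodd
          rw [Nat.not_even_iff] at hodd
          simp only [show (x.length - k + 0) % 2 = 1 by omega] at h
          exact h01 h
        simp [hkx, heven]
      · simp [hkx]
    have := three_mul_sum_two_pow_same_parity x.length
    omega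
  · have hlast : overlapSum x x = ∑ k ∈ Finset.Icc 1 m, (if x.take k <:+ x then 2 ^ k else 0) +
        2 ^ (m + 2) := by
      rw [overlapSum, hm, Finset.sum_Icc_succ_top (by omega), Finset.sum_Icc_succ_top (by omega),
        if_neg hm1, ← hm, List.take_length, if_pos (List.suffix_refl x), add_zero]
    have hrest : 2 * ∑ k ∈ Finset.Icc 1 m, (if x.take k <:+ x then 2 ^ k else 0) < 2 ^ (m + 1) := by
      cases m with
      | zero => simp
      | succ m =>
        rw [Finset.sum_Icc_succ_top (by omega), if_neg (by simpa using hper), add_zero]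
        have h₁ : ∑ k ∈ Finset.Icc 1 m, (if x.take k <:+ x then 2 ^ k else 0) ≤
            ∑ k ∈ Finset.Icc 1 m, 2 ^ k := by
          gcongr
          split_ifs <;> simp
        have h₂ := sum_two_pow_Icc_one m
        rw [pow_succ 2 (m + 1)]
        omega
    rw [hlast, hm]
    simp only [pow_succ] at hrest ⊢
    omega

theorem overlapSum_add_overlapSum_lt {v w : List Bool} (hwv : ¬ w <:+: v)
    (hw : ∀ c, w ≠ List.replicate w.length c) :
    overlapSum w w + overlapSum v w < 2 ^ (w.length + 1) := by
  have hself := three_mul_overlapSum_self_lt hw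
  have hfull : ¬ w.take w.length <:+ v := by
    rw [List.take_length]
    exact fun h => hwv h.isInfix
  have hlen : 2 ≤ w.length := by
    by_contra! h
    match w, h with
    | [], _ => exact hw true rfl
    | [c], _ => exact hw c rfl
  obtain ⟨m, hm⟩ := Nat.exists_eq_add_of_le' hlen
  by_cases hlong : w.take (m + 1) <:+ v
  · set w' := w.take (m + 1) with hw'
    have hlen' : w'.length = m + 1 := by rw [hw', List.length_take]; omega
    have hvw : overlapSum v w = overlapSum w' w' := by
      rw [overlapSum_of_le (j := m + 1) (by omega), overlapSum, hlen']
      · refine Finset.sum_congr rfl fun k hk => ?_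
        rw [Finset.mem_Icc] at hk
        have htake : w'.take k = w.take k := by rw [hw', List.take_take, min_eq_left hk.2]
        have hiff : w.take k <:+ v ↔ w.take k <:+ w' :=
          ⟨fun h => List.suffix_of_suffix_length_le h hlong
            (by rw [hlen', List.length_take]; omega), fun h => h.trans hlong⟩
        simp only [htake, hiff]
      · intro k hk hk'
        rwa [show k = w.length by omega]
    by_cases hconst : ∃ c, w' = List.replicate w'.length c
    · obtain ⟨c, hc⟩ := hconst
      have hww : overlapSum w w = 2 ^ w.length := by
        rw [overlapSum, Finset.sum_eq_single w.length]
        · simp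
        · intro k hk hkn
          rw [Finset.mem_Icc] at hk
          refine if_neg fun h => hw c ?_
          have hlast := getElem_eq_of_take_suffix h (k - 1) (by omega) hk.2
          have hc' : ∀ i (hi : i < m + 1), w[i] = c := by
            intro i hi
            have h₁ : w'[i]? = some c := by
              rw [hc, List.getElem?_replicate_of_lt (by omega)]
            rw [hw', List.getElem?_take_of_lt hi, List.getElem?_eq_getElem (by omega)] at h₁
            exact Option.some.inj h₁
          rw [hc' (k - 1) (by omega)] at hlast
          refine List.ext_getElem (by simp) fun i hi _ => ?_
          rw [List.getElem_replicate]
          rcases Nat.lt_or_ge i (m + 1) with hi' | hi'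
          · exact hc' i hi'
          · rw [hlast]
            congr 1
            omega
        · intro h
          exact absurd (Finset.mem_Icc.2 ⟨by omega, le_rfl⟩) h
      have hle : overlapSum v w + 2 ≤ 2 ^ (m + 1 + 1) :=
        overlapSum_add_two_le (by omega) fun k hk hk' => by rwa [show k = w.length by omega]
      rw [hww, hm]
      simp only [pow_succ] at hle ⊢
      omega
    · push Not at hconst
      have hself' := three_mul_overlapSum_self_lt hconst
      rw [hlen'] at hself'
      rw [hm] at hself ⊢
      rw [hvw]
      simp only [pow_succ] at hself hself' ⊢
      omega
  · have hle : overlapSum v w + 2 ≤ 2 ^ (m + 1) := by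
      refine overlapSum_add_two_le (by omega) fun k hk hk' => ?_
      rcases Nat.lt_or_ge k w.length with h | h
      · rwa [show k = m + 1 by omega]
      · rwa [show k = w.length by omega]
    rw [hm] at hself ⊢
    simp only [pow_succ] at hself hle ⊢
    omega

/-- At `p = 1/2`, a word one letter longer can only be (weakly) favorable against a
constant word. -/
theorem stmt3 (n : ℕ) (hn : 1 ≤ n) (w v : List Bool)
    (hw : w.length = n) (hv : v.length = n + 1) (hsub : ¬ w <:+: v)
    (hwin : Win v w (1/2) ≥ 1/2) :
    w = List.replicate n true ∨ w = List.replicate n false := by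
  by_contra! hne
  have hconst : ∀ c, w ≠ List.replicate w.length c := by
    rintro (_ | _)
    · rw [hw]; exact hne.2
    · rw [hw]; exact hne.1
  have hvw : ¬ v <:+: w := fun h => by
    have := h.length_le
    omega
  have hlt := overlapSum_add_overlapSum_lt hsub hconst
  have hvv := two_pow_le_overlapSum_self (x := v) (List.ne_nil_of_length_eq_add_one hv)
  rw [hw] at hlt
  rw [hv] at hvv
  have := overlapSum_le_of_half_le_Win hvw hsub (by omega) hwin
  omega
end
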